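/- Let a ∈ (0,1/2] and t = π²/(2·𝒦_a(1/√2)²). Then: (1) the function f(r) = (μ_a(r) - μ_a(r'))/log(r'/r), with r' = √(1-r²), is increasing from (0, 1/√2) onto (1, t); in particular, for 0 < r < 1/√2: log(r'/r) < μ_a(r) - μ_a(r') < t·log(r'/r). (2) With g(r) = log(r'/r), for 0 < r < 1/√2: g(r) + √((π/sin(πa))² + g(r)²) < 2·μ_a(r) < t·g(r) + √((π/sin(πa))² + t²·g(r)²). -/

import Mathlib

open Real Set

/-- Shifted factorial (Pochhammer/Appell symbol) `(a)ₙ`. -/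
noncomputable def shiftedFact (a : ℝ) : ℕ → ℝ
  | 0 => 1
  | n + 1 => shiftedFact a n * (a + n)

/-- Gaussian hypergeometric function `F(a,b;c;x)` as a series. -/
noncomputable def hypF (a b c x : ℝ) : ℝ :=
  ∑' n : ℕ, shiftedFact a n * shiftedFact b n / (shiftedFact c n * (Nat.factorial n : ℝ)) * x ^ n

/-- Generalized complete elliptic integral of the first kind `𝒦ₐ(r)`. -/
noncomputable def ellK (a r : ℝ) : ℝ := (Real.pi / 2) * hypF a (1 - a) 1 (r ^ 2)

/-- Generalized complete elliptic integral of the second kind `ℰₐ(r)`. -/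
noncomputable def ellE (a r : ℝ) : ℝ := (Real.pi / 2) * hypF (a - 1) (1 - a) 1 (r ^ 2)

/-- The generalized Grötzsch modulus `μₐ(r)`. -/
noncomputable def muFn (a r : ℝ) : ℝ :=
  Real.pi / (2 * Real.sin (Real.pi * a)) * ellK a (Real.sqrt (1 - r ^ 2)) / ellK a r

/-- Inverse of `μₐ` (on `(0,1)`, where it is a decreasing homeomorphism onto `(0,∞)`). -/
noncomputable def muInv (a : ℝ) : ℝ → ℝ := Function.invFunOn (muFn a) (Set.Ioo 0 1)

/-- The generalized modular function `φ_K^a(r)`. -/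
noncomputable def phiK (a K r : ℝ) : ℝ := muInv a (muFn a r / K)

/-- `η_K^a(x) = (s/s')²` where `s = φ_K^a(√(x/(1+x)))`. -/
noncomputable def etaK (a K x : ℝ) : ℝ :=
  ((phiK a K (Real.sqrt (x / (1 + x)))) / Real.sqrt (1 - (phiK a K (Real.sqrt (x / (1 + x)))) ^ 2)) ^ 2

/-- `λₐ(K)`. -/
noncomputable def lambdaA (a K : ℝ) : ℝ :=
  (phiK a K (1 / Real.sqrt 2) / phiK a (1 / K) (1 / Real.sqrt 2)) ^ 2

/-- The generalized inverse hyperbolic tangent `artanh_p`. -/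
noncomputable def artanhp (p x : ℝ) : ℝ := ∫ t in (0:ℝ)..x, (1 - t ^ p)⁻¹

/-- The inverse hyperbolic tangent. -/
noncomputable def artanh (x : ℝ) : ℝ := (1 / 2) * Real.log ((1 + x) / (1 - x))

/-- Euler beta function. -/
noncomputable def betaB (x y : ℝ) : ℝ := Real.Gamma x * Real.Gamma y / Real.Gamma (x + y)

/-- `μ_{a,c}(r)`, the two-parameter generalized modulus. -/
noncomputable def muAC (a c r : ℝ) : ℝ :=
  betaB a (c - a) * hypF a (c - a) c (1 - r ^ 2) / (2 * hypF a (c - a) c (r ^ 2))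

/-- Inverse of `μ_{a,c}` on `(0,1)`. -/
noncomputable def muACInv (a c : ℝ) : ℝ → ℝ := Function.invFunOn (muAC a c) (Set.Ioo 0 1)

/-- The modular function `φ_K^{a,c}(r)`. -/
noncomputable def phiAC (a c K r : ℝ) : ℝ := muACInv a c (muAC a c r / K)


lemma hasSum_cg {f g : ℕ → ℝ} {S : ℝ} (h : HasSum f S) (e : ∀ n, g n = f n) : HasSum g S := by
  have : g = f := funext e
  rw [this]; exact h

noncomputable def psum (c : ℕ → ℝ) (x : ℝ) : ℝ := ∑' n : ℕ, c n * x ^ n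
def dcf (c : ℕ → ℝ) (n : ℕ) : ℝ := (n + 1) * c (n + 1)

lemma ps_summable0 (c : ℕ → ℝ) (hc : ∀ n, |c n| ≤ ((n:ℝ) + 2) ^ 2) (x : ℝ) (hx : |x| < 1) :
    Summable (fun n : ℕ => c n * x ^ n) := by
  have h0 := summable_pow_mul_geometric_of_norm_lt_one 0 (r := |x|) (by simpa using hx)
  have h1 := summable_pow_mul_geometric_of_norm_lt_one 1 (r := |x|) (by simpa using hx)
  have h2 := summable_pow_mul_geometric_of_norm_lt_one 2 (r := |x|) (by simpa using hx)
  refine Summable.of_norm_bounded ((h2.add (h1.mul_left 4)).add (h0.mul_left 4)) (fun n => ?_)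
  rw [Real.norm_eq_abs, abs_mul, abs_pow]
  calc _ ≤ ((n:ℝ)+2)^2 * |x|^n := by gcongr; exact hc n
    _ = _ := by ring

lemma ps_hasDeriv (c : ℕ → ℝ) (hc : ∀ n, |c n| ≤ ((n:ℝ) + 1)) (x : ℝ) (hx : |x| < 1) :
    HasDerivAt (psum c) (psum (dcf c) x) x := by
  obtain ⟨ρ, h1, h2⟩ := exists_between hx
  have hρ : 0 ≤ ρ := (abs_nonneg x).trans h1.le
  have hd : ∀ n, |dcf c n| ≤ ((n:ℝ) + 2) ^ 2 := by
    intro n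
    have := hc (n+1)
    push_cast at this
    rw [dcf, abs_mul, abs_of_nonneg (by positivity)]
    nlinarith [abs_nonneg (c (n+1))]
  have hsρ := ps_summable0 (fun n => |dcf c n|) (by simpa using hd) ρ (by rwa [abs_of_nonneg hρ])
  have key : HasDerivAt (fun y => ∑' n : ℕ, c n * y ^ n) (∑' n : ℕ, c n * (n * x ^ (n-1))) x := by
    refine hasDerivAt_tsum_of_isPreconnected (u := fun n : ℕ => |c n| * (n * ρ ^ (n-1)))
      (t := Ioo (-ρ) ρ) (y₀ := 0) ?_ isOpen_Ioo isPreconnected_Ioo ?_ ?_ ?_ ?_ ?_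
      (g := fun n y => c n * y ^ n) (g' := fun n y => c n * (n * y ^ (n-1)))
    · rw [← summable_nat_add_iff 1]
      refine hsρ.congr (fun n => ?_)
      simp only [dcf, abs_mul, Nat.add_sub_cancel]
      rw [abs_of_nonneg (by positivity)]
      push_cast; ring
    · intro n y _
      exact (hasDerivAt_pow n y).const_mul (c n)
    · intro n y hy
      have : |y| ≤ ρ := (abs_lt.2 hy).le
      rw [Real.norm_eq_abs, abs_mul, abs_mul, abs_pow, abs_of_nonneg (by positivity : (0:ℝ) ≤ n)]
      gcongr
    · have := abs_lt.1 (lt_of_le_of_lt (abs_nonneg x) h1 |> fun h => by simpa using h : |(0:ℝ)| < ρ)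
      exact this
    · refine summable_of_ne_finset_zero (s := {0}) (fun n hn => ?_)
      simp at hn
      simp [hn]
    · exact abs_lt.1 h1
  have e : (∑' n : ℕ, c n * (n * x ^ (n-1))) = psum (dcf c) x := by
    have hs : Summable (fun n : ℕ => c n * (n * x ^ (n-1))) := by
      rw [← summable_nat_add_iff 1]
      refine (ps_summable0 _ hd x hx).congr (fun n => ?_)
      simp only [dcf, Nat.add_sub_cancel]
      push_cast; ring
    rw [hs.tsum_eq_zero_add]
    simp only [psum, dcf, Nat.add_sub_cancel]
    simp only [Nat.cast_zero, zero_mul, mul_zero, zero_add]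
    refine tsum_congr (fun n => ?_)
    push_cast; ring
  rw [← e]
  exact key

lemma ps_shift (c : ℕ → ℝ) (x S : ℝ) (h : HasSum (fun n => dcf c n * x ^ n) S) :
    HasSum (fun n : ℕ => (n:ℝ) * c n * x ^ n) (x * S) := by
  rw [← hasSum_nat_add_iff' 1]
  simp only [Finset.range_one, Finset.sum_singleton, Nat.cast_zero, zero_mul, sub_zero]
  refine hasSum_cg (h.mul_left x) (fun n => ?_)
  simp only [dcf]; push_cast; ring

open Filter Topology in
lemma ps_abel (c : ℕ → ℝ) (L : ℝ) (hc : ∀ n, |c n| ≤ ((n:ℝ) + 2) ^ 2)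
    (h : Tendsto c atTop (𝓝 L)) :
    Tendsto (fun x => (1 - x) * psum c x) (𝓝[<] 1) (𝓝 L) := by
  let f : ℕ → ℝ := fun n => Nat.casesOn n (c 0) (fun m => c (m+1) - c m)
  have hs : ∀ n, ∑ i ∈ Finset.range (n+1), f i = c n := by
    intro n
    induction n with
    | zero => simp [f]
    | succ k ih => rw [Finset.sum_range_succ, ih]; simp [f]
  have h1 : Tendsto (fun n => ∑ i ∈ Finset.range n, f i) atTop (𝓝 L) := by
    rw [← tendsto_add_atTop_iff_nat 1]
    simpa only [hs] using h
  have h2 := Real.tendsto_tsum_powerSeries_nhdsWithin_lt h1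
  refine h2.congr' ?_
  filter_upwards [Ioo_mem_nhdsLT (show (0:ℝ) < 1 by norm_num)] with x hx
  have hx' : |x| < 1 := by rw [abs_of_pos hx.1]; exact hx.2
  have hS := ps_summable0 c hc x hx'
  have hS1 := (summable_nat_add_iff 1).2 hS
  have e : psum c x = c 0 + ∑' n : ℕ, c (n+1) * x ^ (n+1) := by
    rw [psum, hS.tsum_eq_zero_add]; simp
  have hs2 : HasSum (fun n : ℕ => f (n+1) * x ^ (n+1)) ((psum c x - c 0) - x * psum c x) := by
    have a1 : HasSum (fun n : ℕ => c (n+1) * x ^ (n+1)) (psum c x - c 0) := by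
      rw [e]; simpa using hS1.hasSum
    have a2 : HasSum (fun n : ℕ => x * (c n * x ^ n)) (x * psum c x) := hS.hasSum.mul_left x
    refine hasSum_cg (a1.sub a2) (fun n => ?_)
    simp only [f]; ring
  have hs3 := (hasSum_nat_add_iff (f := fun n => f n * x ^ n) 1).1 hs2
  rw [hs3.tsum_eq]
  simp [f]; ring

noncomputable def cf (a : ℝ) (n : ℕ) : ℝ :=
  shiftedFact a n * shiftedFact (1 - a) n / (shiftedFact 1 n * (Nat.factorial n : ℝ))

lemma sf_one (n : ℕ) : shiftedFact 1 n = (Nat.factorial n : ℝ) := by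
  induction n with
  | zero => simp [shiftedFact]
  | succ k ih => rw [shiftedFact, ih, Nat.factorial_succ]; push_cast; ring

lemma sf_pos (a : ℝ) (ha : 0 < a) (n : ℕ) : 0 < shiftedFact a n := by
  induction n with
  | zero => simp [shiftedFact]
  | succ k ih => rw [shiftedFact]; positivity

lemma cf_zero (a : ℝ) : cf a 0 = 1 := by simp [cf, shiftedFact]

lemma cf_succ (a : ℝ) (n : ℕ) :
    ((n:ℝ) + 1) ^ 2 * cf a (n+1) = ((n:ℝ) ^ 2 + n + a * (1 - a)) * cf a n := by
  have h : (Nat.factorial n : ℝ) ≠ 0 := by positivity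
  have h' : (n:ℝ) + 1 ≠ 0 := by positivity
  rw [cf, cf, sf_one, sf_one, shiftedFact, shiftedFact, Nat.factorial_succ]
  push_cast
  field_simp
  ring

lemma cf_pos (a : ℝ) (ha : a ∈ Set.Ioc (0:ℝ) (1/2)) (n : ℕ) : 0 < cf a n := by
  have := sf_pos a ha.1 n
  have := sf_pos (1-a) (by linarith [ha.2]) n
  rw [cf, sf_one]; positivity

lemma s_bd (a : ℝ) (ha : a ∈ Set.Ioc (0:ℝ) (1/2)) : 0 < a * (1 - a) ∧ a * (1 - a) ≤ 1/4 := by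
  obtain ⟨h1, h2⟩ := ha
  constructor
  · nlinarith
  · nlinarith [sq_nonneg (a - 1/2)]

lemma cf_le (a : ℝ) (ha : a ∈ Set.Ioc (0:ℝ) (1/2)) (n : ℕ) : cf a n ≤ 1 := by
  induction n with
  | zero => rw [cf_zero]
  | succ k ih =>
    have h := cf_succ a k
    have hp := cf_pos a ha k
    have hs := (s_bd a ha).2
    have hk : (0:ℝ) ≤ k := by positivity
    have : ((k:ℝ) + 1) ^ 2 * cf a (k+1) ≤ ((k:ℝ)+1)^2 * 1 := by
      rw [h]
      calc _ ≤ ((k:ℝ) ^ 2 + k + a * (1 - a)) * 1 := by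
            have := (s_bd a ha).1
            gcongr
        _ ≤ _ := by nlinarith
    exact le_of_mul_le_mul_left this (by positivity)

lemma cf_lower (a : ℝ) (ha : a ∈ Set.Ioc (0:ℝ) (1/2)) (n : ℕ) : a * (1 - a) ≤ dcf (cf a) n := by
  induction n with
  | zero =>
    have := cf_succ a 0
    simp [cf_zero] at this
    simp [dcf, this]
  | succ k ih =>
    have h := cf_succ a (k+1)
    have hp := cf_pos a ha (k+1)
    have hs := (s_bd a ha).1
    refine ih.trans ?_
    simp only [dcf] at *
    push_cast at *
    have hk : (0:ℝ) < (k:ℝ)+1+1 := by positivity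
    refine le_of_mul_le_mul_left ?_ hk
    nlinarith [mul_pos hs hp]

open Filter Topology in
lemma dcf_tendsto (a : ℝ) (ha : a ∈ Set.Ioc (0:ℝ) (1/2)) :
    Tendsto (dcf (cf a)) atTop (𝓝 (Real.sin (π * a) / π)) := by
  have hprod : ∀ (b : ℝ) (n : ℕ), ∏ j ∈ Finset.range (n+1), (b + j) = shiftedFact b (n+1) := by
    intro b n
    induction n with
    | zero => simp [shiftedFact]
    | succ k ih => rw [Finset.prod_range_succ, ih, shiftedFact.eq_def b (k+1+1)]
  have h := ((Real.GammaSeq_tendsto_Gamma a).mul (Real.GammaSeq_tendsto_Gamma (1-a)))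
  rw [Real.Gamma_mul_Gamma_one_sub] at h
  have hsin : 0 < Real.sin (π * a) := Real.sin_pos_of_pos_of_lt_pi (by have := ha.1; positivity)
    (by nlinarith [Real.pi_pos, ha.2])
  have h2 := h.inv₀ (by positivity)
  rw [inv_div] at h2
  have h3 : Tendsto (fun n : ℕ => (n:ℝ) / (n + 1)) atTop (𝓝 1) := tendsto_natCast_div_add_atTop 1
  have h4 := h2.mul h3
  rw [mul_one] at h4
  refine h4.congr' ?_
  filter_upwards [eventually_gt_atTop 0] with n hn
  have hn' : (0:ℝ) < n := by exact_mod_cast hn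
  have p1 := sf_pos a ha.1 (n+1)
  have p2 := sf_pos (1-a) (by linarith [ha.2]) (n+1)
  have hnp : (n:ℝ) ^ a * (n:ℝ) ^ (1 - a) = n := by
    rw [← Real.rpow_add hn']; simp
  have hf : (0:ℝ) < (Nat.factorial n : ℝ) := by positivity
  rw [Real.GammaSeq, Real.GammaSeq, hprod, hprod, dcf, cf, sf_one, Nat.factorial_succ]
  have e : (n:ℝ) ^ a * (Nat.factorial n : ℝ) / shiftedFact a (n+1) * ((n:ℝ) ^ (1-a) * (Nat.factorial n : ℝ) / shiftedFact (1-a) (n+1)) = n * (Nat.factorial n : ℝ)^2 / (shiftedFact a (n+1) * shiftedFact (1-a) (n+1)) := by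
        calc _ = ((n:ℝ) ^ a * (n:ℝ) ^ (1 - a)) * (Nat.factorial n : ℝ)^2 / (shiftedFact a (n+1) * shiftedFact (1-a) (n+1)) := by field_simp
      _ = _ := by rw [hnp]
  rw [e]
  push_cast
  field_simp

open Filter Topology in
lemma cf_tendsto (a : ℝ) (ha : a ∈ Set.Ioc (0:ℝ) (1/2)) :
    Tendsto (cf a) atTop (𝓝 0) := by
  rw [← tendsto_add_atTop_iff_nat 1]
  have h := (dcf_tendsto a ha).mul (tendsto_one_div_add_atTop_nhds_zero_nat (𝕜 := ℝ))
  rw [mul_zero] at h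
  refine h.congr (fun n => ?_)
  simp only [dcf]
  field_simp

section
variable (a : ℝ) (ha : a ∈ Set.Ioc (0:ℝ) (1/2))

noncomputable def F0 (a : ℝ) : ℝ → ℝ := psum (cf a)
noncomputable def F1 (a : ℝ) : ℝ → ℝ := psum (dcf (cf a))
noncomputable def F2 (a : ℝ) : ℝ → ℝ := psum (dcf (dcf (cf a)))

lemma cf_abs (a : ℝ) (ha : a ∈ Set.Ioc (0:ℝ) (1/2)) (n : ℕ) : |cf a n| ≤ (n:ℝ) + 1 := by
  rw [abs_of_pos (cf_pos a ha n)]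
  have := cf_le a ha n
  have : (0:ℝ) ≤ n := by positivity
  linarith

lemma dcf_abs (a : ℝ) (ha : a ∈ Set.Ioc (0:ℝ) (1/2)) (n : ℕ) : |dcf (cf a) n| ≤ (n:ℝ) + 1 := by
  have h1 := cf_pos a ha (n+1)
  have := cf_le a ha (n+1)
  have h0 : (0:ℝ) < (n:ℝ) + 1 := by positivity
  rw [dcf, abs_of_pos (by positivity)]
  nlinarith

lemma ddcf_abs (a : ℝ) (ha : a ∈ Set.Ioc (0:ℝ) (1/2)) (n : ℕ) :
    |dcf (dcf (cf a)) n| ≤ ((n:ℝ) + 2) ^ 2 := by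
  have h1 := dcf_abs a ha (n+1)
  rw [dcf, abs_mul, abs_of_pos (by positivity)]
  push_cast at h1
  have : (0:ℝ) ≤ n := by positivity
  nlinarith [abs_nonneg (dcf (cf a) (n+1))]

lemma two_abs (c : ℕ → ℝ) (h : ∀ n : ℕ, |c n| ≤ (n:ℝ) + 1) (n : ℕ) : |c n| ≤ ((n:ℝ) + 2)^2 := by
  have := h n
  have : (0:ℝ) ≤ n := by positivity
  nlinarith

lemma F0_deriv (a : ℝ) (ha : a ∈ Set.Ioc (0:ℝ) (1/2)) (x : ℝ) (hx : |x| < 1) :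
    HasDerivAt (F0 a) (F1 a x) x := ps_hasDeriv _ (cf_abs a ha) x hx

lemma F1_deriv (a : ℝ) (ha : a ∈ Set.Ioc (0:ℝ) (1/2)) (x : ℝ) (hx : |x| < 1) :
    HasDerivAt (F1 a) (F2 a x) x := ps_hasDeriv _ (dcf_abs a ha) x hx

lemma F_ode (a : ℝ) (ha : a ∈ Set.Ioc (0:ℝ) (1/2)) (x : ℝ) (hx : |x| < 1) :
    x * (1 - x) * F2 a x + (1 - 2 * x) * F1 a x - a * (1 - a) * F0 a x = 0 := by
  have s0 : HasSum (fun n => cf a n * x ^ n) (F0 a x) :=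
    (ps_summable0 _ (two_abs _ (cf_abs a ha)) x hx).hasSum
  have s1 : HasSum (fun n => dcf (cf a) n * x ^ n) (F1 a x) :=
    (ps_summable0 _ (two_abs _ (dcf_abs a ha)) x hx).hasSum
  have s2 : HasSum (fun n => dcf (dcf (cf a)) n * x ^ n) (F2 a x) :=
    (ps_summable0 _ (ddcf_abs a ha) x hx).hasSum
  have s1' := ps_shift _ _ _ s1
  have s2' := ps_shift _ _ _ s2
  have s2'' : HasSum (fun n : ℕ => (n:ℝ) * ((n:ℝ) - 1) * cf a n * x ^ n) (x * (x * F2 a x)) := by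
    rw [← hasSum_nat_add_iff' 1]
    simp only [Finset.range_one, Finset.sum_singleton, Nat.cast_zero, zero_mul, sub_zero]
    refine hasSum_cg (s2'.mul_left x) (fun n => ?_)
    simp only [dcf]; push_cast; ring
  have tot := (((s2'.sub s2'').add s1).sub (s1'.mul_left 2)).sub (s0.mul_left (a * (1 - a)))
  have z : HasSum (fun _ : ℕ => (0:ℝ)) 0 := hasSum_zero
  have e := tot.unique (a₂ := 0) (by
    refine hasSum_cg z (fun n => ?_)
    have := cf_succ a n
    simp only [dcf]
    linear_combination (x ^ n) * this)
  linarith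
end

lemma F0_pos (a : ℝ) (ha : a ∈ Set.Ioc (0:ℝ) (1/2)) (x : ℝ) (hx : 0 ≤ x) (hx1 : x < 1) :
    0 < F0 a x := by
  refine Summable.tsum_pos (ps_summable0 _ (two_abs _ (cf_abs a ha)) x (by rwa [abs_of_nonneg hx]))
    (fun n => ?_) 0 ?_
  · have := cf_pos a ha n; positivity
  · simp [cf_zero]

lemma F1_pos (a : ℝ) (ha : a ∈ Set.Ioc (0:ℝ) (1/2)) (x : ℝ) (hx : 0 ≤ x) (hx1 : x < 1) :
    0 < F1 a x := by
  refine Summable.tsum_pos (ps_summable0 _ (two_abs _ (dcf_abs a ha)) x (by rwa [abs_of_nonneg hx]))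
    (fun n => ?_) 0 ?_
  · have := (s_bd a ha).1.trans_le (cf_lower a ha n); positivity
  · have := (s_bd a ha).1.trans_le (cf_lower a ha 0); simpa using this

lemma F0_zero (a : ℝ) : F0 a 0 = 1 := by
  rw [F0, psum, tsum_eq_single 0]
  · simp [cf_zero]
  · intro n hn; simp [hn]

lemma F0_lower (a : ℝ) (ha : a ∈ Set.Ioc (0:ℝ) (1/2)) (x : ℝ) (hx : 0 ≤ x) (hx1 : x < 1) :
    1 - a * (1 - a) * Real.log (1 - x) ≤ F0 a x := by
  have hx' : |x| < 1 := by rwa [abs_of_nonneg hx]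
  have hS := ps_summable0 _ (two_abs _ (cf_abs a ha)) x hx'
  have h1 := (Real.hasSum_pow_div_log_of_abs_lt_one hx').mul_left (a * (1 - a))
  have h2 := ((summable_nat_add_iff 1).2 hS).hasSum
  have := hasSum_le (fun n => ?_) h1 h2
  · rw [F0, psum, hS.tsum_eq_zero_add]
    simp only [cf_zero, pow_zero]
    linarith
  · have h3 := cf_lower a ha n
    simp only [dcf] at h3
    have hp : (0:ℝ) < (n:ℝ) + 1 := by positivity
    have h4 : a * (1 - a) / ((n:ℝ) + 1) ≤ cf a (n+1) := by
      rw [div_le_iff₀ hp]; linarith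
    calc a * (1 - a) * (x ^ (n+1) / ((n:ℝ) + 1)) = a * (1 - a) / ((n:ℝ) + 1) * x ^ (n+1) := by ring
      _ ≤ _ := by gcongr

lemma abs_lt_of_Ioo {x : ℝ} (hx : x ∈ Ioo (0:ℝ) 1) : |x| < 1 ∧ |1 - x| < 1 := by
  rw [abs_of_pos hx.1, abs_of_pos (by linarith [hx.2])]
  exact ⟨hx.2, by linarith [hx.1]⟩

lemma F0r_deriv (a : ℝ) (ha : a ∈ Set.Ioc (0:ℝ) (1/2)) (x : ℝ) (hx : x ∈ Ioo (0:ℝ) 1) :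
    HasDerivAt (fun x => F0 a (1 - x)) (- F1 a (1 - x)) x := by
  have := (F0_deriv a ha (1 - x) (abs_lt_of_Ioo hx).2).comp x ((hasDerivAt_id x).const_sub 1)
  exact this.congr_deriv (by simp)

lemma F1r_deriv (a : ℝ) (ha : a ∈ Set.Ioc (0:ℝ) (1/2)) (x : ℝ) (hx : x ∈ Ioo (0:ℝ) 1) :
    HasDerivAt (fun x => F1 a (1 - x)) (- F2 a (1 - x)) x := by
  have := (F1_deriv a ha (1 - x) (abs_lt_of_Ioo hx).2).comp x ((hasDerivAt_id x).const_sub 1)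
  exact this.congr_deriv (by simp)

noncomputable def Wr (a x : ℝ) : ℝ :=
  x * (1 - x) * (F1 a x * F0 a (1 - x) + F0 a x * F1 a (1 - x))

lemma Wr_deriv (a : ℝ) (ha : a ∈ Set.Ioc (0:ℝ) (1/2)) (x : ℝ) (hx : x ∈ Ioo (0:ℝ) 1) :
    HasDerivAt (Wr a) 0 x := by
  have d0 := F0_deriv a ha x (abs_lt_of_Ioo hx).1
  have d1 := F1_deriv a ha x (abs_lt_of_Ioo hx).1
  have r0 := F0r_deriv a ha x hx
  have r1 := F1r_deriv a ha x hx
  have o := F_ode a ha x (abs_lt_of_Ioo hx).1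
  have o' := F_ode a ha (1 - x) (abs_lt_of_Ioo hx).2
  have := ((hasDerivAt_id x).mul ((hasDerivAt_id x).const_sub 1)).mul ((d1.mul r0).add (d0.mul r1))
  refine this.congr_deriv ?_
  simp only [id, Pi.mul_apply, Pi.add_apply]
  linear_combination (F0 a (1 - x)) * o - (F0 a x) * o'

open Filter Topology in
lemma Wr_eq (a : ℝ) (ha : a ∈ Set.Ioc (0:ℝ) (1/2)) (x : ℝ) (hx : x ∈ Ioo (0:ℝ) 1) :
    Wr a x = Real.sin (π * a) / π := by
  have hconst : ∀ y ∈ Ioo (0:ℝ) 1, Wr a y = Wr a x := by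
    intro y hy
    refine isOpen_Ioo.is_const_of_deriv_eq_zero isPreconnected_Ioo ?_ ?_ hy hx
    · intro z hz; exact (Wr_deriv a ha z hz).differentiableAt.differentiableWithinAt
    · intro z hz; exact (Wr_deriv a ha z hz).deriv
  have hT : Tendsto (fun y : ℝ => 1 - y) (𝓝[>] 0) (𝓝[<] 1) := by
    refine tendsto_nhdsWithin_iff.2 ⟨?_, ?_⟩
    · have : Tendsto (fun y : ℝ => 1 - y) (𝓝 0) (𝓝 (1 - 0)) := by
        apply Continuous.tendsto; fun_prop
      rw [sub_zero] at this
      exact this.mono_left nhdsWithin_le_nhds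
    · filter_upwards [self_mem_nhdsWithin] with y hy
      simp only [mem_Ioi, mem_Iio] at *
      linarith
  have A0 := (ps_abel (cf a) 0 (two_abs _ (cf_abs a ha)) (cf_tendsto a ha)).comp hT
  have A1 := (ps_abel (dcf (cf a)) _ (two_abs _ (dcf_abs a ha)) (dcf_tendsto a ha)).comp hT
  have c0 : Tendsto (F0 a) (𝓝[>] 0) (𝓝 (F0 a 0)) :=
    (F0_deriv a ha 0 (by simp)).continuousAt.tendsto.mono_left nhdsWithin_le_nhds
  have c1 : Tendsto (F1 a) (𝓝[>] 0) (𝓝 (F1 a 0)) :=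
    (F1_deriv a ha 0 (by simp)).continuousAt.tendsto.mono_left nhdsWithin_le_nhds
  have c2 : Tendsto (fun y : ℝ => 1 - y) (𝓝[>] 0) (𝓝 1) := hT.mono_right nhdsWithin_le_nhds
  have lim := c2.mul ((c1.mul A0).add (c0.mul A1))
  rw [F0_zero] at lim
  have lim2 : Tendsto (Wr a) (𝓝[>] 0) (𝓝 (Real.sin (π * a) / π)) := by
    have e : (1:ℝ) * (F1 a 0 * 0 + 1 * (Real.sin (π * a) / π)) = Real.sin (π * a) / π := by ring
    rw [e] at lim
    refine lim.congr (fun y => ?_)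
    simp only [Function.comp, Wr, F0, F1]
    ring
  have lim3 : Tendsto (Wr a) (𝓝[>] 0) (𝓝 (Wr a x)) := by
    refine tendsto_const_nhds.congr' ?_
    filter_upwards [Ioo_mem_nhdsGT (show (0:ℝ) < 1 by norm_num)] with y hy
    exact (hconst y hy).symm
  exact tendsto_nhds_unique lim3 lim2

/-- the key concavity quantity -/
noncomputable def Pf (a x : ℝ) : ℝ :=
  x * (1 - x) * (a * (1 - a) * F0 a x - (1 - 2 * x) * F1 a x - 3 * (x * (1 - x)) * (F1 a x ^ 2 / F0 a x))

lemma Pf_deriv (a : ℝ) (ha : a ∈ Set.Ioc (0:ℝ) (1/2)) (x : ℝ) (hx : 0 ≤ x) (hx1 : x < 1) :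
    HasDerivAt (Pf a) (x * (1 - x) * F1 a x * (2 - 5 * (a * (1 - a)) +
      3 * (x * (1 - x)) * (F1 a x ^ 2 / F0 a x ^ 2))) x := by
  have hx' : |x| < 1 := by rwa [abs_of_nonneg hx]
  have d0 := F0_deriv a ha x hx'
  have d1 := F1_deriv a ha x hx'
  have o := F_ode a ha x hx'
  have hp := (F0_pos a ha x hx hx1).ne'
  have dx := (hasDerivAt_id x).mul ((hasDerivAt_id x).const_sub 1)
  have dl := (((hasDerivAt_id x).const_mul 2).const_sub 1)
  have := dx.mul (((d0.const_mul (a * (1 - a))).sub (dl.mul d1)).sub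
    ((dx.const_mul 3).mul ((d1.pow 2).div d0 hp)))
  refine this.congr_deriv ?_
  simp only [id, Pi.mul_apply, Pi.pow_apply, Pi.sub_apply, Pi.div_apply]
  have o2 : x * (1 - x) * F2 a x = a * (1 - a) * F0 a x - (1 - 2 * x) * F1 a x := by linarith
  generalize F2 a x = f2 at *
  generalize F1 a x = f1 at *
  generalize F0 a x = f0 at *
  push_cast
  have hu : f1 / f0 * f0 = f1 := by field_simp
  have e1 : f1 ^ 2 / f0 = (f1 / f0) ^ 2 * f0 := by field_simp
  have e2 : f1 ^ 2 / f0 ^ 2 = (f1 / f0) ^ 2 := by field_simp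
  have e3 : (2 * f1 ^ (2 - 1) * f2 * f0 - f1 ^ 2 * f1) / f0 ^ 2 = 2 * (f1 / f0) * f2 - (f1 / f0) ^ 2 * f1 := by
    norm_num; field_simp
  rw [e1, e2, e3]
  generalize f1 / f0 = u at *
  subst hu
  linear_combination (-(1 - 2 * x) - 6 * (x * (1 - x)) * u) * o2

lemma Pf_pos (a : ℝ) (ha : a ∈ Set.Ioc (0:ℝ) (1/2)) (x : ℝ) (hx : x ∈ Ioo (0:ℝ) 1) :
    0 < Pf a x := by
  have hm : StrictMonoOn (Pf a) (Ico 0 1) := by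
    refine strictMonoOn_of_deriv_pos (convex_Ico 0 1) ?_ ?_
    · intro z hz
      exact (Pf_deriv a ha z hz.1 hz.2).continuousAt.continuousWithinAt
    · rw [interior_Ico]
      intro z hz
      rw [(Pf_deriv a ha z hz.1.le hz.2).deriv]
      have h1 := F1_pos a ha z hz.1.le hz.2
      have h0 := F0_pos a ha z hz.1.le hz.2
      have hs := (s_bd a ha).2
      have hz1 : 0 < 1 - z := by linarith [hz.2]
      have hz0 := hz.1
      have : 0 < 2 - 5 * (a * (1 - a)) := by linarith
      positivity
  have := hm (a := 0) (b := x) ⟨le_refl _, by norm_num⟩ ⟨hx.1.le, hx.2⟩ hx.1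
  simpa [Pf] using this

noncomputable def qf (a x : ℝ) : ℝ := F1 a x / F0 a x ^ 3

lemma qf_mono (a : ℝ) (ha : a ∈ Set.Ioc (0:ℝ) (1/2)) : StrictMonoOn (qf a) (Ioo 0 1) := by
  have hd : ∀ x ∈ Ioo (0:ℝ) 1, HasDerivAt (qf a)
      ((F2 a x * F0 a x - 3 * F1 a x ^ 2) / F0 a x ^ 4) x := by
    intro x hx
    have d0 := F0_deriv a ha x (abs_lt_of_Ioo hx).1
    have d1 := F1_deriv a ha x (abs_lt_of_Ioo hx).1
    have hp := F0_pos a ha x hx.1.le hx.2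
    refine (d1.div (d0.pow 3) (by simpa using hp.ne')).congr_deriv ?_
    simp only [Pi.pow_apply]
    norm_num
    field_simp
  refine strictMonoOn_of_deriv_pos (convex_Ioo 0 1) ?_ ?_
  · intro z hz
    exact (hd z hz).continuousAt.continuousWithinAt
  · rw [interior_Ioo]
    intro x hx
    rw [(hd x hx).deriv]
    have hp := F0_pos a ha x hx.1.le hx.2
    have hP := Pf_pos a ha x hx
    have o := F_ode a ha x (abs_lt_of_Ioo hx).1
    have hX : 0 < x * (1 - x) := mul_pos hx.1 (by linarith [hx.2])
    have e : Pf a x * F0 a x = (x * (1 - x)) ^ 2 * (F2 a x * F0 a x - 3 * F1 a x ^ 2) := by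
      rw [Pf]
      field_simp
      linear_combination (- x * (1 - x) * F0 a x) * o
    have : 0 < (x * (1 - x)) ^ 2 * (F2 a x * F0 a x - 3 * F1 a x ^ 2) := by
      rw [← e]; positivity
    have := pos_of_mul_pos_right this (by positivity)
    positivity

noncomputable def hf (a x : ℝ) : ℝ := 1 / F0 a x ^ 2 + 1 / F0 a (1 - x) ^ 2

lemma hf_deriv (a : ℝ) (ha : a ∈ Set.Ioc (0:ℝ) (1/2)) (x : ℝ) (hx : x ∈ Ioo (0:ℝ) 1) :
    HasDerivAt (hf a) (2 * (qf a (1 - x) - qf a x)) x := by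
  have d0 := F0_deriv a ha x (abs_lt_of_Ioo hx).1
  have r0 := F0r_deriv a ha x hx
  have hp := F0_pos a ha x hx.1.le hx.2
  have hp' := F0_pos a ha (1 - x) (by linarith [hx.2]) (by linarith [hx.1])
  refine (((hasDerivAt_const x (1:ℝ)).div (d0.pow 2) (by simpa using hp.ne')).add
    ((hasDerivAt_const x (1:ℝ)).div (r0.pow 2) (by simpa using hp'.ne'))).congr_deriv ?_
  simp only [Pi.pow_apply, qf]
  norm_num
  field_simp
  ring

lemma hf_mono (a : ℝ) (ha : a ∈ Set.Ioc (0:ℝ) (1/2)) : StrictMonoOn (hf a) (Ioc 0 (1/2)) := by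
  refine strictMonoOn_of_deriv_pos (convex_Ioc 0 _) ?_ ?_
  · intro z hz
    exact (hf_deriv a ha z ⟨hz.1, by linarith [hz.2]⟩).continuousAt.continuousWithinAt
  · rw [interior_Ioc]
    intro x hx
    rw [(hf_deriv a ha x ⟨hx.1, by linarith [hx.2]⟩).deriv]
    have : qf a x < qf a (1 - x) := qf_mono a ha ⟨hx.1, by linarith [hx.2]⟩
      ⟨by linarith [hx.2], by linarith [hx.1]⟩ (by linarith [hx.2])
    linarith

open Filter Topology in
lemma hf_tendsto (a : ℝ) (ha : a ∈ Set.Ioc (0:ℝ) (1/2)) : Tendsto (hf a) (𝓝[>] 0) (𝓝 1) := by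
  have c0 : Tendsto (F0 a) (𝓝[>] 0) (𝓝 (F0 a 0)) :=
    (F0_deriv a ha 0 (by simp)).continuousAt.tendsto.mono_left nhdsWithin_le_nhds
  rw [F0_zero] at c0
  have l1 : Tendsto (fun x => 1 - a * (1 - a) * Real.log x) (𝓝[>] 0) atTop := by
    have h1 : Tendsto (fun x => a * (1 - a) * Real.log x) (𝓝[>] 0) atBot :=
      Real.tendsto_log_nhdsGT_zero.const_mul_atBot (s_bd a ha).1
    have := tendsto_atTop_add_const_left _ 1 (tendsto_neg_atBot_atTop.comp h1)
    refine this.congr (fun x => ?_)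
    simp only [Function.comp]; ring
  have l2 : Tendsto (fun x => F0 a (1 - x)) (𝓝[>] 0) atTop := by
    refine tendsto_atTop_mono' _ ?_ l1
    filter_upwards [Ioo_mem_nhdsGT (show (0:ℝ) < 1 by norm_num)] with y hy
    have := F0_lower a ha (1 - y) (by linarith [hy.2]) (by linarith [hy.1])
    simpa using this
  have l3 : Tendsto (fun x => 1 / F0 a (1 - x) ^ 2) (𝓝[>] 0) (𝓝 0) := by
    have := ((tendsto_pow_atTop (α := ℝ) two_ne_zero).comp l2).inv_tendsto_atTop
    refine this.congr (fun x => ?_)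
    simp
  have l4 := ((c0.pow 2).inv₀ (by norm_num)).add l3
  norm_num at l4
  refine l4.congr (fun x => ?_)
  simp [hf]

lemma hf_gt (a : ℝ) (ha : a ∈ Set.Ioc (0:ℝ) (1/2)) (x : ℝ) (hx : x ∈ Ioc (0:ℝ) (1/2)) :
    1 < hf a x := by
  have h1 : hf a (x/2) < hf a x := hf_mono a ha ⟨by linarith [hx.1], by linarith [hx.1, hx.2]⟩ hx
    (by linarith [hx.1])
  refine lt_of_le_of_lt ?_ h1
  refine le_of_tendsto (hf_tendsto a ha) ?_
  filter_upwards [Ioo_mem_nhdsGT (show (0:ℝ) < x/2 by linarith [hx.1])] with y hy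
  exact (hf_mono a ha ⟨hy.1, by linarith [hy.2, hx.2, hx.1]⟩
    ⟨by linarith [hx.1], by linarith [hx.1, hx.2]⟩ hy.2).le

noncomputable def Mf (a x : ℝ) : ℝ := π / (2 * Real.sin (π * a)) * (F0 a (1 - x) / F0 a x)
noncomputable def Nf (a x : ℝ) : ℝ :=
  π / (2 * Real.sin (π * a)) * (F0 a (1 - x) / F0 a x - F0 a x / F0 a (1 - x))
noncomputable def Df (x : ℝ) : ℝ := Real.log ((1 - x) / x) / 2

lemma sin_pos' (a : ℝ) (ha : a ∈ Set.Ioc (0:ℝ) (1/2)) : 0 < Real.sin (π * a) :=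
  Real.sin_pos_of_pos_of_lt_pi (by have := ha.1; positivity) (by nlinarith [Real.pi_pos, ha.2])

lemma Nf_deriv (a : ℝ) (ha : a ∈ Set.Ioc (0:ℝ) (1/2)) (x : ℝ) (hx : x ∈ Ioo (0:ℝ) 1) :
    HasDerivAt (Nf a) (- hf a x * (1 / (2 * (x * (1 - x))))) x := by
  have d0 := F0_deriv a ha x (abs_lt_of_Ioo hx).1
  have r0 := F0r_deriv a ha x hx
  have hp := F0_pos a ha x hx.1.le hx.2
  have hp' := F0_pos a ha (1 - x) (by linarith [hx.2]) (by linarith [hx.1])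
  have hs := sin_pos' a ha
  have hX : 0 < x * (1 - x) := mul_pos hx.1 (by linarith [hx.2])
  have hW := Wr_eq a ha x hx
  have hW2 : F1 a x * F0 a (1 - x) + F0 a x * F1 a (1 - x) =
      Real.sin (π * a) / π / (x * (1 - x)) := by
    rw [← hW, Wr, mul_div_cancel_left₀ _ hX.ne']
  have hpi := Real.pi_pos
  refine (((r0.div d0 hp.ne').sub (d0.div r0 hp'.ne')).const_mul
    (π / (2 * Real.sin (π * a)))).congr_deriv ?_
  have e : (-F1 a (1 - x) * F0 a x - F0 a (1 - x) * F1 a x) / F0 a x ^ 2 -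
      (F1 a x * F0 a (1 - x) - F0 a x * -F1 a (1 - x)) / F0 a (1 - x) ^ 2
      = - (F1 a x * F0 a (1 - x) + F0 a x * F1 a (1 - x)) * hf a x := by
    rw [hf]; ring
  rw [e, hW2]
  have hx0 := hx.1.ne'
  have hx1 : 1 - x ≠ 0 := by linarith [hx.2]
  field_simp

lemma Df_deriv (x : ℝ) (hx : x ∈ Ioo (0:ℝ) 1) :
    HasDerivAt Df (- (1 / (2 * (x * (1 - x))))) x := by
  have hx0 := hx.1.ne'
  have hx1 : 1 - x ≠ 0 := by linarith [hx.2]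
  have := ((((hasDerivAt_id x).const_sub 1).div (hasDerivAt_id x) hx0).log
    (div_ne_zero hx1 hx0)).div_const 2
  refine this.congr_deriv ?_
  simp only [id, Pi.div_apply]
  field_simp
  ring

lemma ND_mvt (a : ℝ) (ha : a ∈ Set.Ioc (0:ℝ) (1/2)) (x y : ℝ) (hx : 0 < x) (hxy : x < y)
    (hy : y < 1) : ∃ z ∈ Ioo x y, Nf a x - Nf a y = hf a z * (Df x - Df y) := by
  obtain ⟨z, hz, h⟩ := exists_ratio_hasDerivAt_eq_ratio_slope (Nf a)
    (fun x => - hf a x * (1 / (2 * (x * (1 - x))))) hxy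
    (fun z hz => (Nf_deriv a ha z ⟨by linarith [hz.1], by linarith [hz.2]⟩).continuousAt.continuousWithinAt)
    (fun z hz => Nf_deriv a ha z ⟨by linarith [hz.1], by linarith [hz.2]⟩)
    Df (fun x => - (1 / (2 * (x * (1 - x)))))
    (fun z hz => (Df_deriv z ⟨by linarith [hz.1], by linarith [hz.2]⟩).continuousAt.continuousWithinAt)
    (fun z hz => Df_deriv z ⟨by linarith [hz.1], by linarith [hz.2]⟩)
  refine ⟨z, hz, ?_⟩
  have hX : 0 < z * (1 - z) := mul_pos (by linarith [hz.1]) (by linarith [hz.2])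
  have hX' : (0:ℝ) < 1 / (2 * (z * (1 - z))) := by positivity
  refine mul_right_cancel₀ hX'.ne' ?_
  linear_combination -h

lemma Df_half : Df (1/2) = 0 := by norm_num [Df]
lemma Nf_half (a : ℝ) : Nf a (1/2) = 0 := by norm_num [Nf]

lemma Df_anti (x y : ℝ) (hx : 0 < x) (hxy : x < y) (hy : y < 1) : Df y < Df x := by
  rw [Df, Df]
  have h1 : 0 < (1 - y) / y := div_pos (by linarith) (by linarith)
  have : (1 - y) / y < (1 - x) / x := by
    rw [div_lt_div_iff₀ (by linarith) hx]; nlinarith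
  have := Real.log_lt_log h1 this
  linarith

lemma Df_pos (x : ℝ) (hx : x ∈ Ioo (0:ℝ) (1/2)) : 0 < Df x := by
  rw [← Df_half]; exact Df_anti _ _ hx.1 hx.2 (by norm_num)

noncomputable def Qf (a x : ℝ) : ℝ := Nf a x / Df x

lemma Qf_mvt (a : ℝ) (ha : a ∈ Set.Ioc (0:ℝ) (1/2)) (x : ℝ) (hx : x ∈ Ioo (0:ℝ) (1/2)) :
    ∃ z ∈ Ioo x (1/2), Qf a x = hf a z := by
  obtain ⟨z, hz, h⟩ := ND_mvt a ha x (1/2) hx.1 hx.2 (by norm_num)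
  refine ⟨z, hz, ?_⟩
  rw [Df_half, Nf_half, sub_zero, sub_zero] at h
  rw [Qf, h]
  have := Df_pos x hx
  field_simp

lemma Qf_gt (a : ℝ) (ha : a ∈ Set.Ioc (0:ℝ) (1/2)) (x : ℝ) (hx : x ∈ Ioo (0:ℝ) (1/2)) :
    hf a x < Qf a x := by
  obtain ⟨z, hz, h⟩ := Qf_mvt a ha x hx
  rw [h]
  exact hf_mono a ha ⟨hx.1, hx.2.le⟩ ⟨hx.1.trans hz.1, hz.2.le⟩ hz.1

lemma Qf_lt (a : ℝ) (ha : a ∈ Set.Ioc (0:ℝ) (1/2)) (x : ℝ) (hx : x ∈ Ioo (0:ℝ) (1/2)) :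
    Qf a x < hf a (1/2) := by
  obtain ⟨z, hz, h⟩ := Qf_mvt a ha x hx
  rw [h]
  exact hf_mono a ha ⟨hx.1.trans hz.1, hz.2.le⟩ ⟨by norm_num, le_refl _⟩ hz.2

lemma Qf_mono (a : ℝ) (ha : a ∈ Set.Ioc (0:ℝ) (1/2)) : StrictMonoOn (Qf a) (Ioo 0 (1/2)) := by
  intro x hx y hy hxy
  obtain ⟨z, hz, h⟩ := ND_mvt a ha x y hx.1 hxy (by linarith [hy.2])
  have h1 : hf a z < hf a y := hf_mono a ha ⟨hx.1.trans hz.1, by linarith [hz.2, hy.2]⟩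
    ⟨hy.1, hy.2.le⟩ hz.2
  have h2 := Qf_gt a ha y hy
  have hD := Df_anti x y hx.1 hxy (by linarith [hy.2])
  have hDx := Df_pos x hx
  have hDy := Df_pos y hy
  have hN : Nf a y = Qf a y * Df y := by rw [Qf]; field_simp
  rw [Qf, div_lt_iff₀ hDx]
  nlinarith

open Filter Topology in
lemma Df_tendsto : Tendsto Df (𝓝[>] 0) atTop := by
  have h1 : Tendsto (fun x : ℝ => x⁻¹ + (-1)) (𝓝[>] 0) atTop :=
    tendsto_atTop_add_const_right _ _ tendsto_inv_nhdsGT_zero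
  have h2 := (Real.tendsto_log_atTop.comp h1).atTop_div_const (show (0:ℝ) < 2 by norm_num)
  refine h2.congr' ?_
  filter_upwards [self_mem_nhdsWithin] with x hx
  have : x ≠ 0 := ne_of_gt hx
  simp only [Function.comp, Df]
  congr 2
  field_simp
  ring

open Filter Topology in
lemma Qf_image (a : ℝ) (ha : a ∈ Set.Ioc (0:ℝ) (1/2)) :
    Qf a '' Ioo 0 (1/2) = Ioo 1 (hf a (1/2)) := by
  apply Subset.antisymm
  · rintro _ ⟨x, hx, rfl⟩
    exact ⟨(hf_gt a ha x ⟨hx.1, hx.2.le⟩).trans (Qf_gt a ha x hx), Qf_lt a ha x hx⟩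
  · intro y hy
    have hcont : ContinuousOn (Qf a) (Ioo 0 (1/2)) := by
      intro x hx
      have hx1 : x ∈ Ioo (0:ℝ) 1 := ⟨hx.1, by linarith [hx.2]⟩
      exact ((Nf_deriv a ha x hx1).continuousAt.div (Df_deriv x hx1).continuousAt
        (Df_pos x hx).ne').continuousWithinAt
    obtain ⟨x2, hx2, h2⟩ : ∃ x2 ∈ Ioo (0:ℝ) (1/2), y < Qf a x2 := by
      have hc : Tendsto (hf a) (𝓝[<] (1/2)) (𝓝 (hf a (1/2))) :=
        (hf_deriv a ha (1/2) ⟨by norm_num, by norm_num⟩).continuousAt.tendsto.mono_left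
          nhdsWithin_le_nhds
      have e1 := hc.eventually (lt_mem_nhds hy.2)
      have e2 := Ioo_mem_nhdsLT (show (0:ℝ) < 1/2 by norm_num)
      obtain ⟨x, hx, hx'⟩ := (e1.and e2).exists
      exact ⟨x, hx', hx.trans (Qf_gt a ha x hx')⟩
    obtain ⟨x1, hx1, h1⟩ : ∃ x1 ∈ Ioo (0:ℝ) (1/2), Qf a x1 < y := by
      have e1 := (hf_tendsto a ha).eventually (gt_mem_nhds (show (1:ℝ) < (1 + y) / 2 by linarith [hy.1]))
      have e2 := Ioo_mem_nhdsGT (show (0:ℝ) < 1/2 by norm_num)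
      obtain ⟨d, hd, hd'⟩ := (e1.and e2).exists
      have e3 := Df_tendsto.eventually_gt_atTop (Nf a d / ((y - 1) / 2))
      have e4 := Ioo_mem_nhdsGT hd'.1
      obtain ⟨x, hx, hx'⟩ := (e3.and e4).exists
      have hxm : x ∈ Ioo (0:ℝ) (1/2) := ⟨hx'.1, hx'.2.trans hd'.2⟩
      refine ⟨x, hxm, ?_⟩
      obtain ⟨z, hz, h⟩ := ND_mvt a ha x d hx'.1 hx'.2 (by linarith [hd'.2])
      have h1 : hf a z < hf a d := hf_mono a ha ⟨hx'.1.trans hz.1, by linarith [hz.2, hd'.2]⟩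
        ⟨hd'.1, hd'.2.le⟩ hz.2
      have hD := Df_anti x d hx'.1 hx'.2 (by linarith [hd'.2])
      have hDd := Df_pos d hd'
      have hy1 : 0 < (y - 1) / 2 := by linarith [hy.1]
      rw [div_lt_iff₀ hy1] at hx
      rw [Qf, div_lt_iff₀ (Df_pos x hxm)]
      nlinarith
    exact isPreconnected_Ioo.intermediate_value hx1 hx2 hcont ⟨h1.le, h2.le⟩

theorem stmt17 (a : ℝ) (ha : a ∈ Set.Ioc (0:ℝ) (1/2)) :
    (StrictMonoOn
        (fun r : ℝ => (muFn a r - muFn a (Real.sqrt (1 - r ^ 2))) /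
          Real.log (Real.sqrt (1 - r ^ 2) / r)) (Set.Ioo 0 (1 / Real.sqrt 2)) ∧
      (fun r : ℝ => (muFn a r - muFn a (Real.sqrt (1 - r ^ 2))) /
          Real.log (Real.sqrt (1 - r ^ 2) / r)) '' (Set.Ioo 0 (1 / Real.sqrt 2)) =
        Set.Ioo 1 (Real.pi ^ 2 / (2 * (ellK a (1 / Real.sqrt 2)) ^ 2))) ∧
    ∀ r : ℝ, r ∈ Set.Ioo 0 (1 / Real.sqrt 2) →
      (Real.log (Real.sqrt (1 - r ^ 2) / r) <
          muFn a r - muFn a (Real.sqrt (1 - r ^ 2)) ∧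
        muFn a r - muFn a (Real.sqrt (1 - r ^ 2)) <
          Real.pi ^ 2 / (2 * (ellK a (1 / Real.sqrt 2)) ^ 2) *
            Real.log (Real.sqrt (1 - r ^ 2) / r)) ∧
      (Real.log (Real.sqrt (1 - r ^ 2) / r) +
          Real.sqrt ((Real.pi / Real.sin (Real.pi * a)) ^ 2 +
            (Real.log (Real.sqrt (1 - r ^ 2) / r)) ^ 2) < 2 * muFn a r ∧
        2 * muFn a r <
          Real.pi ^ 2 / (2 * (ellK a (1 / Real.sqrt 2)) ^ 2) *
              Real.log (Real.sqrt (1 - r ^ 2) / r) +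
            Real.sqrt ((Real.pi / Real.sin (Real.pi * a)) ^ 2 +
              (Real.pi ^ 2 / (2 * (ellK a (1 / Real.sqrt 2)) ^ 2)) ^ 2 *
                (Real.log (Real.sqrt (1 - r ^ 2) / r)) ^ 2)) := by
  have hq : ∀ r ∈ Set.Ioo 0 (1 / Real.sqrt 2), 0 < r ∧ r ^ 2 ∈ Ioo (0:ℝ) (1/2) := by
    intro r hr
    refine ⟨hr.1, by have := hr.1; positivity, ?_⟩
    have h2 : (1 / Real.sqrt 2) ^ 2 = 1 / 2 := by
      rw [div_pow, Real.sq_sqrt (by norm_num)]; norm_num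
    rw [← h2]
    exact pow_lt_pow_left₀ hr.2 hr.1.le two_ne_zero
  have ht : Real.pi ^ 2 / (2 * (ellK a (1 / Real.sqrt 2)) ^ 2) = hf a (1/2) := by
    have h2 : (1 / Real.sqrt 2) ^ 2 = 1 / 2 := by
      rw [div_pow, Real.sq_sqrt (by norm_num)]; norm_num
    have e : ellK a (1 / Real.sqrt 2) = π / 2 * F0 a (1/2) := by rw [ellK, h2]; rfl
    have hp := F0_pos a ha (1/2) (by norm_num) (by norm_num)
    have hpi := Real.pi_pos
    have e2 : (1:ℝ) - 1/2 = 1/2 := by norm_num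
    rw [e, hf, e2]
    field_simp
    norm_num
  rw [ht]
  have hlog : ∀ r ∈ Set.Ioo 0 (1 / Real.sqrt 2), Real.log (Real.sqrt (1 - r ^ 2) / r) = Df (r ^ 2) := by
    intro r hr
    obtain ⟨h0, h1⟩ := hq r hr
    rw [Df, ← Real.log_sqrt (div_nonneg (by linarith [h1.2]) h1.1.le),
      Real.sqrt_div (by linarith [h1.2]), Real.sqrt_sq h0.le]
  have hM1 : ∀ r ∈ Set.Ioo 0 (1 / Real.sqrt 2), muFn a r = Mf a (r ^ 2) := by
    intro r hr
    obtain ⟨h0, h1⟩ := hq r hr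
    have e : muFn a r = Real.pi / (2 * Real.sin (Real.pi * a)) *
      (π / 2 * F0 a (Real.sqrt (1 - r ^ 2) ^ 2)) / (π / 2 * F0 a (r ^ 2)) := rfl
    rw [e, Real.sq_sqrt (by linarith [h1.2]), Mf, mul_div_assoc,
      mul_div_mul_left _ _ (by have := Real.pi_pos; positivity)]
  have hM2 : ∀ r ∈ Set.Ioo 0 (1 / Real.sqrt 2),
      muFn a (Real.sqrt (1 - r ^ 2)) = Mf a (1 - r ^ 2) := by
    intro r hr
    obtain ⟨h0, h1⟩ := hq r hr
    have e : muFn a (Real.sqrt (1 - r ^ 2)) = Real.pi / (2 * Real.sin (Real.pi * a)) *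
      (π / 2 * F0 a (Real.sqrt (1 - Real.sqrt (1 - r ^ 2) ^ 2) ^ 2)) /
        (π / 2 * F0 a (Real.sqrt (1 - r ^ 2) ^ 2)) := rfl
    rw [e, Real.sq_sqrt (show 0 ≤ 1 - r ^ 2 by linarith [h1.2]), Real.sq_sqrt (by linarith [h1.1]),
      Mf, mul_div_assoc, mul_div_mul_left _ _ (by have := Real.pi_pos; positivity)]
  have hN : ∀ x, Mf a x - Mf a (1 - x) = Nf a x := by
    intro x
    rw [Mf, Mf, Nf, sub_sub_cancel]; ring
  have hfQ : ∀ r ∈ Set.Ioo 0 (1 / Real.sqrt 2), (muFn a r - muFn a (Real.sqrt (1 - r ^ 2))) /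
      Real.log (Real.sqrt (1 - r ^ 2) / r) = Qf a (r ^ 2) := by
    intro r hr
    rw [hlog r hr, hM1 r hr, hM2 r hr, hN, Qf]
  refine ⟨⟨?_, ?_⟩, ?_⟩
  · intro r hr u hu hru
    simp only [hfQ r hr, hfQ u hu]
    exact Qf_mono a ha (hq r hr).2 (hq u hu).2 (pow_lt_pow_left₀ hru hr.1.le two_ne_zero)
  · rw [Set.image_congr (g := fun r => Qf a (r ^ 2)) hfQ, ← Qf_image a ha]
    apply Subset.antisymm
    · rintro _ ⟨r, hr, rfl⟩
      exact ⟨r ^ 2, (hq r hr).2, rfl⟩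
    · rintro _ ⟨x, hx, rfl⟩
      refine ⟨Real.sqrt x, ⟨Real.sqrt_pos.2 hx.1, ?_⟩, ?_⟩
      · rw [← Real.sqrt_one, ← Real.sqrt_div (by norm_num)]
        exact Real.sqrt_lt_sqrt hx.1.le hx.2
      · simp only [Real.sq_sqrt hx.1.le]
  · intro r hr
    obtain ⟨h0, h1⟩ := hq r hr
    rw [hlog r hr, hM1 r hr, hM2 r hr, hN]
    have hD := Df_pos _ h1
    have hNQ : Nf a (r ^ 2) = Qf a (r ^ 2) * Df (r ^ 2) := by rw [Qf]; field_simp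
    have hQ1 := (hf_gt a ha _ ⟨h1.1, h1.2.le⟩).trans (Qf_gt a ha _ h1)
    have hQ2 := Qf_lt a ha _ h1
    have b1 : Df (r ^ 2) < Nf a (r ^ 2) := by rw [hNQ]; nlinarith
    have b2 : Nf a (r ^ 2) < hf a (1/2) * Df (r ^ 2) := by rw [hNQ]; nlinarith
    refine ⟨⟨b1, b2⟩, ?_⟩
    have hs := sin_pos' a ha
    have hpi := Real.pi_pos
    have p0 := F0_pos a ha (r ^ 2) h1.1.le (by linarith [h1.2])
    have p1 := F0_pos a ha (1 - r ^ 2) (by linarith [h1.2]) (by linarith [h1.1])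
    have m0 : 0 < Mf a (r ^ 2) := by rw [Mf]; positivity
    have m1 : 0 < Mf a (1 - r ^ 2) := by rw [Mf, sub_sub_cancel]; positivity
    have mm : 4 * (Mf a (r ^ 2) * Mf a (1 - r ^ 2)) = (Real.pi / Real.sin (Real.pi * a)) ^ 2 := by
      rw [Mf, Mf, sub_sub_cancel]; field_simp; norm_num
    have key : 2 * Mf a (r ^ 2) = Nf a (r ^ 2) +
        Real.sqrt ((Real.pi / Real.sin (Real.pi * a)) ^ 2 + Nf a (r ^ 2) ^ 2) := by
      rw [← mm, ← hN, show 4 * (Mf a (r ^ 2) * Mf a (1 - r ^ 2)) +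
        (Mf a (r ^ 2) - Mf a (1 - r ^ 2)) ^ 2 = (Mf a (r ^ 2) + Mf a (1 - r ^ 2)) ^ 2 by ring,
        Real.sqrt_sq (by positivity)]
      ring
    have hNp : 0 < Nf a (r ^ 2) := hD.trans b1
    rw [key]
    constructor
    · refine add_lt_add b1 (Real.sqrt_lt_sqrt (by positivity) ?_)
      have := pow_lt_pow_left₀ b1 hD.le two_ne_zero
      linarith
    · refine add_lt_add b2 (Real.sqrt_lt_sqrt (by positivity) ?_)
      have := pow_lt_pow_left₀ b2 hNp.le two_ne_zero
      rw [mul_pow] at this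
      linarith
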